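/- Let π=π(λ,π_0,τ,a) be a λ-path, fix j with 1≤j≤r−1, and consider sequences σ_{j,i}=r_{β_{j,i}}σ_{j,i−1} in W^v/W^v_λ with σ_{j,0}=τ_j, σ_{j,s_j}=τ_{j+1}, positive real roots β_{j,i}, and ξ_i=σ_{j,i}(λ). Then for each i, the LS condition (i) σ_{j,i}<σ_{j,i−1} in Bruhat–Chevalley order on W^v/W^v_λ is equivalent to the Hecke condition (vi) β_{j,i}(ξ_{i−1})<0. If these hold for all i=1,…,s_j, then w_+(a_j) < w_-(a_j) in the Bruhat–Chevalley order of W^v/W^v_λ. -/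

import Mathlib

open scoped Pointwise
open Filter

noncomputable section

set_option maxHeartbeats 1000000

/-- A root generating system realized in the real vector space `V = Y ⊗ ℝ`
(the model affine apartment `𝔸`), with the freedom condition `F(𝒮)`. -/
structure ApartmentData where
  /-- the affine apartment `𝔸 = V` -/
  V : Type
  [instAdd : AddCommGroup V]
  [instMod : Module ℝ V]
  /-- the (finite) index set of the Kac-Moody matrix -/
  I : Type
  [instFin : Fintype I]
  /-- the simple roots `α_i`, viewed as linear forms on `V` -/
  al : I → (V →ₗ[ℝ] ℝ)
  /-- the simple coroots `α_i^∨` -/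
  alv : I → V
  pairing_diag : ∀ i, al i (alv i) = 2
  pairing_int : ∀ i j, ∃ n : ℤ, al j (alv i) = (n : ℝ)
  pairing_offdiag : ∀ i j, i ≠ j → al j (alv i) ≤ 0
  pairing_zero_iff : ∀ i j, al j (alv i) = 0 ↔ al i (alv j) = 0
  /-- the cocharacter lattice `Y ⊂ V` -/
  Y : AddSubgroup V
  alv_mem : ∀ i, alv i ∈ Y
  /-- the freedom condition `F(𝒮)`: the simple roots are free -/
  free_al : LinearIndependent ℝ al
  /-- the freedom condition `F(𝒮)`: the simple coroots are free -/
  free_alv : LinearIndependent ℝ alv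

attribute [instance] ApartmentData.instAdd ApartmentData.instMod ApartmentData.instFin

namespace ApartmentData

variable (D : ApartmentData)

/-- the linear map `v ↦ v - φ(v) • c` (a reflection when `φ(c) = 2`) -/
def reflMap (p : (D.V →ₗ[ℝ] ℝ) × D.V) : D.V →ₗ[ℝ] D.V :=
  LinearMap.id - (p.1).smulRight p.2

lemma reflMap_invol (p : (D.V →ₗ[ℝ] ℝ) × D.V) (h2 : p.1 p.2 = 2) :
    Function.Involutive (D.reflMap p) := by
  intro v
  simp only [reflMap, LinearMap.sub_apply, LinearMap.id_apply, LinearMap.smulRight_apply,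
    map_sub, map_smul, smul_eq_mul, h2]
  module

/-- the reflection associated to a pair (root, coroot) with `φ(c) = 2`, as a linear
automorphism of `V` -/
def reflEquiv (p : (D.V →ₗ[ℝ] ℝ) × D.V) (h2 : p.1 p.2 = 2) : D.V ≃ₗ[ℝ] D.V :=
  LinearEquiv.ofLinear (D.reflMap p) (D.reflMap p)
    (by ext v; exact D.reflMap_invol p h2 v) (by ext v; exact D.reflMap_invol p h2 v)

/-- the simple reflection `r_i` -/
def s (i : D.I) : D.V ≃ₗ[ℝ] D.V :=
  D.reflEquiv (D.al i, D.alv i) (D.pairing_diag i)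

/-- the vectorial Weyl group `W^v`, as a group of linear automorphisms of `V` -/
def W : Subgroup (D.V ≃ₗ[ℝ] D.V) := Subgroup.closure (Set.range D.s)

/-- the set `Φ` of real roots, encoded as pairs `(α, α^∨) = (w(α_i), w(α_i^∨))` -/
def Phi : Set ((D.V →ₗ[ℝ] ℝ) × D.V) :=
  {p | ∃ w ∈ D.W, ∃ i, p.1 = (D.al i).comp (w.symm : D.V →ₗ[ℝ] D.V) ∧ p.2 = w (D.alv i)}

lemma phi_two {p : (D.V →ₗ[ℝ] ℝ) × D.V} (hp : p ∈ D.Phi) : p.1 p.2 = (2 : ℝ) := by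
  obtain ⟨w, _, i, h1, h2⟩ := hp
  rw [h1, h2]
  simp [D.pairing_diag i]

/-- the negative of a root pair -/
def negP (p : (D.V →ₗ[ℝ] ℝ) × D.V) : (D.V →ₗ[ℝ] ℝ) × D.V := (-p.1, -p.2)

/-- the positive real roots `Φ⁺` -/
def PhiPos : Set ((D.V →ₗ[ℝ] ℝ) × D.V) :=
  {p | p ∈ D.Phi ∧ ∃ n : D.I → ℕ, p.1 = ∑ i, (n i : ℝ) • D.al i}

/-- the negative real roots `Φ⁻` -/
def PhiNeg : Set ((D.V →ₗ[ℝ] ℝ) × D.V) := {p | D.negP p ∈ D.PhiPos}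

/-- the open fundamental chamber `C^v_f` -/
def Cf : Set D.V := {v | ∀ i, 0 < D.al i v}

/-- the closed fundamental chamber -/
def CfBar : Set D.V := {v | ∀ i, 0 ≤ D.al i v}

/-- `λ` is dominant -/
def isDominant (lam : D.V) : Prop := lam ∈ D.CfBar

/-- the Tits cone `𝒯`, union of the `W^v`-translates of the closed fundamental chamber -/
def Tits : Set D.V := {v | ∃ w ∈ D.W, (w.symm : D.V ≃ₗ[ℝ] D.V) v ∈ D.CfBar}

/-- product of the simple reflections along a word -/
def wordProd (l : List D.I) : D.V ≃ₗ[ℝ] D.V := (l.map D.s).prod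

/-- the length of `w ∈ W^v` with respect to the simple reflections -/
def length (w : D.V ≃ₗ[ℝ] D.V) : ℕ :=
  sInf {n | ∃ l : List D.I, l.length = n ∧ D.wordProd l = w}

/-- `t` is a reflection of `W^v` (along a real root) -/
def IsReflection (t : D.V ≃ₗ[ℝ] D.V) : Prop :=
  ∃ p ∈ D.Phi, ∀ v, t v = D.reflMap p v

/-- covering-type step of the Bruhat–Chevalley order on `W^v` -/
def bruhatCov (u v : D.V ≃ₗ[ℝ] D.V) : Prop :=
  (∃ t, D.IsReflection t ∧ v = t * u) ∧ D.length u < D.length v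

/-- the Bruhat–Chevalley order on `W^v` -/
def bruhatLE : (D.V ≃ₗ[ℝ] D.V) → (D.V ≃ₗ[ℝ] D.V) → Prop :=
  Relation.ReflTransGen D.bruhatCov

/-- the Bruhat–Chevalley order on `W^v/W^v_λ` (on coset representatives) -/
def bruhatLEmod (lam : D.V) (u v : D.V ≃ₗ[ℝ] D.V) : Prop :=
  ∃ u' v', u' ∈ D.W ∧ v' ∈ D.W ∧ u' lam = u lam ∧ v' lam = v lam ∧ D.bruhatLE u' v'

/-- the strict Bruhat–Chevalley order on `W^v/W^v_λ` -/
def bruhatLTmod (lam : D.V) (u v : D.V ≃ₗ[ℝ] D.V) : Prop :=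
  D.bruhatLEmod lam u v ∧ u lam ≠ v lam

/-- the length `ℓ_λ` on `W^v/W^v_λ`: length of the minimal coset representative -/
def lenMod (lam : D.V) (u : D.V ≃ₗ[ℝ] D.V) : ℕ :=
  sInf {n | ∃ v, v ∈ D.W ∧ v lam = u lam ∧ D.length v = n}

/-- the half-apartment `D(φ,k) = {v | φ(v) + k ≥ 0}` -/
def Dhalf (φ : D.V →ₗ[ℝ] ℝ) (k : ℤ) : Set D.V := {v | 0 ≤ φ v + k}

/-- `φ(x) ∈ ℤ` -/
def isIntOn (φ : D.V →ₗ[ℝ] ℝ) (x : D.V) : Prop := ∃ k : ℤ, φ x = (k : ℝ)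

/-- the relative length `ℓ_x(w)` computed on a direction `ξ = w λ`: the number of
positive real roots `β` with `β(x) ∈ ℤ` and `β(ξ) < 0` (the walls of direction
`Ker β` through `x` separating `C_f^v` from `w C_f^v`). -/
def ddimTerm (x ξ : D.V) : ℕ :=
  Set.ncard {φ : D.V →ₗ[ℝ] ℝ | (∃ c, (φ, c) ∈ D.PhiPos) ∧ D.isIntOn φ x ∧ φ ξ < 0}

/-- `f_Ω(α)`: the set of integers `k` with `Ω ⊂ D(α,k)` -/
def fSet (Ω : Filter D.V) (φ : D.V →ₗ[ℝ] ℝ) : Set ℤ := {k | D.Dhalf φ k ∈ Ω}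

/-- `f_Ω(α) = inf {k ∈ ℤ | Ω ⊂ D(α,k)} ∈ ℤ ∪ {+∞}` -/
def fval (Ω : Filter D.V) (φ : D.V →ₗ[ℝ] ℝ) : WithTop ℤ :=
  sInf ((fun k : ℤ => (k : WithTop ℤ)) '' D.fSet Ω φ)

/-- the support of a filter on `𝔸`: the smallest affine subspace containing a set
of the filter -/
def suppSpan (Ω : Filter D.V) : AffineSubspace ℝ D.V :=
  ⨅ S ∈ Ω.sets, affineSpan ℝ S

/-- the filter `Ω' + C` for a filter `Ω'` and a set (cone) `C` -/
def fadd (Ω : Filter D.V) (C : Set D.V) : Filter D.V :=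
  Filter.generate {T | ∃ S ∈ Ω, T = S + C}

/-- the closed vectorial chamber `w · C̄_f^v` -/
def Cchamber (w : D.V ≃ₗ[ℝ] D.V) : Set D.V := {v | (w.symm : D.V ≃ₗ[ℝ] D.V) v ∈ D.CfBar}

end ApartmentData

/-- A piecewise linear `λ`-path `π = π(λ, π_0, τ, a)` in the apartment:
linear with derivative `τ_j(λ)` on `[a_{j-1}, a_j]` for `1 ≤ j ≤ r`. -/
structure PWPath (D : ApartmentData) (lam : D.V) where
  /-- the starting point `π_0 = π(0)` -/
  p0 : D.V
  r : ℕ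
  rpos : 0 < r
  /-- representatives in `W^v` of the cosets `τ_j ∈ W^v/W^v_λ` (used for `j = 1, …, r`) -/
  τ : ℕ → D.V ≃ₗ[ℝ] D.V
  τ_mem : ∀ j, τ j ∈ D.W
  τ_ne : ∀ j, 1 ≤ j → j < r → τ j lam ≠ τ (j+1) lam
  /-- the subdivision `a_0 = 0 < a_1 < … < a_r = 1` -/
  a : ℕ → ℝ
  a0 : a 0 = 0
  ar : a r = 1
  amono : ∀ j < r, a j < a (j+1)

namespace PWPath

variable {D : ApartmentData} {lam : D.V}

/-- the value `π(t)` of the path -/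
def eval (P : PWPath D lam) (t : ℝ) : D.V :=
  P.p0 + ∑ i ∈ Finset.range P.r, (min t (P.a (i+1)) - min t (P.a i)) • (P.τ (i+1)) lam

/-- the left derivative `π'_-(t)` (for `0 < t ≤ 1`) -/
def leftD (P : PWPath D lam) (t : ℝ) : D.V := (P.τ (sInf {j | t ≤ P.a j})) lam

/-- the right derivative `π'_+(t)` (for `0 ≤ t < 1`) -/
def rightD (P : PWPath D lam) (t : ℝ) : D.V := (P.τ (sInf {j | t < P.a j})) lam

end PWPath

/-- a `W^v_z`-chain from `ξstart` to `ξend`: positive real roots `β_1, …, β_s`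
with `ξ_i = r_{β_i}(ξ_{i-1})`, `β_i(ξ_{i-1}) < 0` and `β_i(z) ∈ ℤ` -/
def IsHeckeChain (D : ApartmentData) (z ξstart ξend : D.V) : Prop :=
  ∃ s : ℕ, ∃ ξ : ℕ → D.V, ∃ β : ℕ → (D.V →ₗ[ℝ] ℝ) × D.V,
    ξ 0 = ξstart ∧ ξ s = ξend ∧
    ∀ i < s, β i ∈ D.PhiPos ∧ ξ (i+1) = D.reflMap (β i) (ξ i) ∧
      (β i).1 (ξ i) < 0 ∧ D.isIntOn (β i).1 z

namespace PWPath

variable {D : ApartmentData} {lam : D.V}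

/-- `π` is a Hecke path of shape `λ` -/
def IsHecke (P : PWPath D lam) : Prop :=
  ∀ t ∈ Set.Ioo (0:ℝ) 1, IsHeckeChain D (P.eval t) (P.leftD t) (P.rightD t)

/-- `π` is "in `Y`": `π(0), π(1), λ ∈ Y` -/
def InY (P : PWPath D lam) : Prop := P.p0 ∈ D.Y ∧ P.eval 1 ∈ D.Y ∧ lam ∈ D.Y

/-- the dual dimension `ddim(π) = Σ_{t>0} ℓ_{π(t)}(w_-(t))` -/
def ddim (P : PWPath D lam) : ℕ :=
  ∑ᶠ t ∈ Set.Ioc (0:ℝ) 1, D.ddimTerm (P.eval t) (P.leftD t)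

/-- the codimension `codim(π) = Σ_{t<1} ℓ_{π(t)}(w_+(t))` -/
def codim (P : PWPath D lam) : ℕ :=
  ∑ᶠ t ∈ Set.Ico (0:ℝ) 1, D.ddimTerm (P.eval t) (P.rightD t)

/-- `π` is a Lakshmibai–Seshadri (LS) path of shape `λ`: it starts in `Y` and,
for all `j = 1, …, r-1`, there is an `a_j`-chain from `τ_j` to `τ_{j+1}`. -/
def IsLS (P : PWPath D lam) : Prop :=
  P.p0 ∈ D.Y ∧
  ∀ j, 1 ≤ j → j < P.r →
    ∃ s : ℕ, ∃ σ : ℕ → D.V ≃ₗ[ℝ] D.V, ∃ β : ℕ → (D.V →ₗ[ℝ] ℝ) × D.V,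
      (∀ i, σ i ∈ D.W) ∧ σ 0 lam = P.τ j lam ∧ σ s lam = P.τ (j+1) lam ∧
      ∀ i < s, β i ∈ D.PhiPos ∧ σ (i+1) lam = D.reflMap (β i) (σ i lam) ∧
        D.bruhatLTmod lam (σ (i+1)) (σ i) ∧
        (∃ k : ℤ, P.a j * (β i).1 (σ (i+1) lam) = (k : ℝ)) ∧
        D.lenMod lam (σ (i+1)) + 1 = D.lenMod lam (σ i)

end PWPath

section Operators

variable (D : ApartmentData)

/-- the root operator `ẽ_α` (as a relation between paths, viewed as functions):
`Q` is the minimal integral value of `α(π(·))` on `[0,1]`, `q` the greatest number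
such that `α(π([0,q])) ≥ Q`, `θ > q` minimal with `α(π(θ)) = Q`, and
`ẽ_α π = π_1 * r_α(π_2) * π_3` for the corresponding cutting. -/
def IsTildeE (i : D.I) (f f' : ℝ → D.V) : Prop :=
  ∃ Q : ℤ, ∃ q θ : ℝ, 0 ≤ q ∧ q < θ ∧ θ ≤ 1 ∧
    (∃ t ∈ Set.Icc (0:ℝ) 1, D.al i (f t) = (Q:ℝ)) ∧
    (∀ k : ℤ, (∃ t ∈ Set.Icc (0:ℝ) 1, D.al i (f t) = (k:ℝ)) → (Q:ℝ) ≤ (k:ℝ)) ∧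
    (∀ t ∈ Set.Icc (0:ℝ) q, (Q:ℝ) ≤ D.al i (f t)) ∧
    (∀ q' : ℝ, q < q' → q' ≤ 1 → ∃ t ∈ Set.Icc (0:ℝ) q', D.al i (f t) < (Q:ℝ)) ∧
    D.al i (f θ) = (Q:ℝ) ∧ (∀ t : ℝ, q < t → t < θ → D.al i (f t) < (Q:ℝ)) ∧
    (∀ t : ℝ, t ≤ q → f' t = f t) ∧
    (∀ t : ℝ, q ≤ t → t ≤ θ → f' t = f q + D.reflMap (D.al i, D.alv i) (f t - f q)) ∧
    (∀ t : ℝ, θ ≤ t → f' t = f t +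
      (D.reflMap (D.al i, D.alv i) (f θ - f q) - (f θ - f q)))

/-- Littelmann's root operator `e_α` (as a relation between paths): `Q = min α(π)`,
`q` minimal attaining it, `x` maximal `≤ q` with `α(π(x)) = Q+1`, and
`e_α π = π_1 * r_α(π_2) * π_3` for the cutting at `x` and `q`. -/
def IsLittE (i : D.I) (f f' : ℝ → D.V) : Prop :=
  ∃ Q : ℝ, IsLeast ((fun t => D.al i (f t)) '' Set.Icc (0:ℝ) 1) Q ∧
  ∃ x q : ℝ, 0 ≤ x ∧ x < q ∧ q ≤ 1 ∧
    D.al i (f q) = Q ∧ (∀ t : ℝ, 0 ≤ t → t < q → Q < D.al i (f t)) ∧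
    D.al i (f x) = Q + 1 ∧ (∀ t : ℝ, x < t → t ≤ q → D.al i (f t) < Q + 1) ∧
    (∀ t : ℝ, t ≤ x → f' t = f t) ∧
    (∀ t : ℝ, x ≤ t → t ≤ q → f' t = f x + D.reflMap (D.al i, D.alv i) (f t - f x)) ∧
    (∀ t : ℝ, q ≤ t → f' t = f t +
      (D.reflMap (D.al i, D.alv i) (f q - f x) - (f q - f x)))

/-- Littelmann's root operator `f_α` (as a relation between paths): `Q = min α(π)`,
`q` maximal attaining it, `x` minimal `≥ q` with `α(π(x)) = Q+1`, and
`f_α π = π_1 * r_α(π_2) * π_3` for the cutting at `q` and `x`. -/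
def IsLittF (i : D.I) (f f' : ℝ → D.V) : Prop :=
  ∃ Q : ℝ, IsLeast ((fun t => D.al i (f t)) '' Set.Icc (0:ℝ) 1) Q ∧
  ∃ q x : ℝ, 0 ≤ q ∧ q < x ∧ x ≤ 1 ∧
    D.al i (f q) = Q ∧ (∀ t : ℝ, q < t → t ≤ 1 → Q < D.al i (f t)) ∧
    D.al i (f x) = Q + 1 ∧ (∀ t : ℝ, q ≤ t → t < x → D.al i (f t) < Q + 1) ∧
    (∀ t : ℝ, t ≤ q → f' t = f t) ∧
    (∀ t : ℝ, q ≤ t → t ≤ x → f' t = f q + D.reflMap (D.al i, D.alv i) (f t - f q)) ∧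
    (∀ t : ℝ, x ≤ t → f' t = f t +
      (D.reflMap (D.al i, D.alv i) (f x - f q) - (f x - f q)))

end Operators

/-- Data of Tits' minimal Kac-Moody group `G = G_𝒮` over a field `K` with a
normalized discrete valuation `ω` (residue field `κ ⊇ ℂ`), together with the
filtrations of its real root groups, the action of `N(K)` on the apartment, and
the completed unipotent subgroups `U^{pm+}_Ω`, `U^{nm-}_Ω` coming from Kumar's
maximal Kac-Moody groups. -/
structure KMGroupData (D : ApartmentData) where
  /-- the group `G(K)` -/
  G : Type
  [instG : Group G]
  /-- the normalizer `N(K)` of the standard maximal split torus -/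
  N : Subgroup G
  /-- the standard maximal split torus `T(K)` -/
  T : Subgroup G
  /-- `H = T(𝒪) = Ker ν` -/
  Hsub : Subgroup G
  H_le_T : Hsub ≤ T
  T_le_N : T ≤ N
  /-- the filtration subgroups `U_{α,k} = x_α({t ∈ K | ω(t) ≥ k})` -/
  U : ((D.V →ₗ[ℝ] ℝ) × D.V) → ℤ → Subgroup G
  U_antitone : ∀ p, ∀ k l : ℤ, k ≤ l → U p l ≤ U p k
  /-- the real root groups `U_α(K)` -/
  Ur : ((D.V →ₗ[ℝ] ℝ) × D.V) → Subgroup G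
  Ur_eq : ∀ p, Ur p = ⨆ k : ℤ, U p k
  /-- the action `ν` of `N(K)` on the apartment `𝔸` by affine maps -/
  nu : ↥N →* (D.V ≃ᵃ[ℝ] D.V)
  /-- `H` acts trivially on `𝔸` -/
  nu_H : ∀ n : ↥N, (n : G) ∈ Hsub → ∀ v, nu n v = v
  /-- the set `Δ` of all roots (real and imaginary) of `𝔤_𝒮`, as linear forms -/
  Delta : Set (D.V →ₗ[ℝ] ℝ)
  phi_sub_delta : ∀ p ∈ D.Phi, p.1 ∈ Delta
  /-- the groups `U^{pm+}_Ω = G(K) ∩ U^{max}_Ω(Δ⁺)` -/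
  Upmp : Filter D.V → Subgroup G
  /-- the groups `U^{nm-}_Ω = G(K) ∩ U^{max}_Ω(Δ⁻)` -/
  Unmm : Filter D.V → Subgroup G
  Upmp_le : ∀ Ω, Upmp Ω ≤ ⨆ p ∈ D.PhiPos, Ur p
  le_Upmp : ∀ Ω : Filter D.V, ∀ p ∈ D.PhiPos,
    (⨆ (k : ℤ) (_ : k ∈ D.fSet Ω p.1), U p k) ≤ Upmp Ω
  Unmm_le : ∀ Ω, Unmm Ω ≤ ⨆ p ∈ D.PhiNeg, Ur p
  le_Unmm : ∀ Ω : Filter D.V, ∀ p ∈ D.PhiNeg,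
    (⨆ (k : ℤ) (_ : k ∈ D.fSet Ω p.1), U p k) ≤ Unmm Ω
  /-- an abstract index for the integrable highest (or lowest) weight `𝔤`-modules -/
  Mod : Type
  /-- the set of weights of `𝔥` on the module `M` -/
  wts : Mod → Set (D.V →ₗ[ℝ] ℝ)
  /-- the stabilizer in `G(K)` of the lattice `M_Ω` -/
  stabM : Mod → Set D.V → Subgroup G
  /-- the stabilizer in `G(K)` of the lattice `𝔤_Ω` -/
  stabg : Set D.V → Subgroup G
  /-- the residue field `κ` of `K` -/
  kres : Type
  [instK : Field kres]

attribute [instance] KMGroupData.instG KMGroupData.instK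

namespace ApartmentData

variable (D : ApartmentData)

/-- `Ω` is narrow: `f_Ω(α) + f_Ω(-α) ∈ {0,1}` for all real roots `α` -/
def narrow (Ω : Filter D.V) : Prop :=
  ∀ p ∈ D.Phi, D.fval Ω p.1 + D.fval Ω (-p.1) ∈ ({0, 1} : Set (WithTop ℤ))

/-- `Ω` is almost open: `f_Ω(α) + f_Ω(-α) ≠ 0` for all real roots `α` -/
def almostOpen (Ω : Filter D.V) : Prop :=
  ∀ p ∈ D.Phi, D.fval Ω p.1 + D.fval Ω (-p.1) ≠ 0

end ApartmentData

namespace KMGroupData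

variable {D : ApartmentData} (Γ : KMGroupData D)

/-- `U^+(K)`, generated by the positive real root groups -/
def Uplus : Subgroup Γ.G := ⨆ p ∈ D.PhiPos, Γ.Ur p

/-- `U^-(K)`, generated by the negative real root groups -/
def Uminus : Subgroup Γ.G := ⨆ p ∈ D.PhiNeg, Γ.Ur p

/-- `U_{α,Ω} = U_{α,f_Ω(α)}` -/
def Ufil (Ω : Filter D.V) (p : (D.V →ₗ[ℝ] ℝ) × D.V) : Subgroup Γ.G :=
  ⨆ (k : ℤ) (_ : k ∈ D.fSet Ω p.1), Γ.U p k

/-- `U_Ω`, generated by the `U_{α,Ω}` for `α ∈ Φ` -/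
def UOm (Ω : Filter D.V) : Subgroup Γ.G := ⨆ p ∈ D.Phi, Γ.Ufil Ω p

/-- `U^+_Ω = U_Ω ∩ U^+(K)` -/
def UOmP (Ω : Filter D.V) : Subgroup Γ.G := Γ.UOm Ω ⊓ Γ.Uplus

/-- `U^-_Ω = U_Ω ∩ U^-(K)` -/
def UOmM (Ω : Filter D.V) : Subgroup Γ.G := Γ.UOm Ω ⊓ Γ.Uminus

/-- `U^{(α)}_Ω`, generated by `U_{α,Ω}` and `U_{-α,Ω}` -/
def Usl (Ω : Filter D.V) (p : (D.V →ₗ[ℝ] ℝ) × D.V) : Subgroup Γ.G :=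
  Γ.Ufil Ω p ⊔ Γ.Ufil Ω (D.negP p)

/-- `N^{(α)}_Ω = N(K) ∩ U^{(α)}_Ω` -/
def Nsl (Ω : Filter D.V) (p : (D.V →ₗ[ℝ] ℝ) × D.V) : Subgroup Γ.G := Γ.Usl Ω p ⊓ Γ.N

/-- `N^u_Ω`, generated by the `N^{(α)}_Ω` for `α ∈ Φ` -/
def Nu (Ω : Filter D.V) : Subgroup Γ.G := ⨆ p ∈ D.Phi, Γ.Nsl Ω p

/-- `U^{pm}_Ω`, generated by `U_Ω` and `U^{pm+}_Ω` -/
def UOmPM (Ω : Filter D.V) : Subgroup Γ.G := Γ.UOm Ω ⊔ Γ.Upmp Ω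

/-- `U^{nm}_Ω`, generated by `U_Ω` and `U^{nm-}_Ω` -/
def UOmNM (Ω : Filter D.V) : Subgroup Γ.G := Γ.UOm Ω ⊔ Γ.Unmm Ω

/-- the subgroup `G^{(α)}(K)` generated by `T(K)`, `U_α(K)` and `U_{-α}(K)` -/
def Gsl (p : (D.V →ₗ[ℝ] ℝ) × D.V) : Subgroup Γ.G := Γ.Ur p ⊔ Γ.Ur (D.negP p) ⊔ Γ.T

/-- the group `P̃_Ω`: stabilizer of `𝔤_Ω` and of `M_Ω` for every integrable highest
(or lowest) weight module `M` -/
def Ptil (Ω : Set D.V) : Subgroup Γ.G := Γ.stabg Ω ⊓ ⨅ m : Γ.Mod, Γ.stabM m Ω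

/-- `Ñ_Ω = P̃_Ω ∩ N(K)` -/
def Ntil (Ω : Set D.V) : Subgroup Γ.G := Γ.Ptil Ω ⊓ Γ.N

/-- the set `𝒫 ⊂ X`: union of `Δ` and the weights of all the modules `M` -/
def Pscript : Set (D.V →ₗ[ℝ] ℝ) := Γ.Delta ∪ ⋃ m : Γ.Mod, Γ.wts m

/-- the `𝒫`-enclosure of a subset `Ω` of `𝔸`: the intersection of all half-spaces
`D(λ,k)` (for `λ ∈ 𝒫`, `k ∈ ℤ`) containing `Ω` -/
def clP (Ω : Set D.V) : Set D.V :=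
  ⋂ φ ∈ Γ.Pscript, ⋂ k ∈ {k : ℤ | Ω ⊆ D.Dhalf φ k}, D.Dhalf φ k

/-- `Z` is an intersection of half-apartments `D(α,k)`, `α ∈ Δ`, `k ∈ ℤ` -/
def IsEnclSet (Z : Set D.V) : Prop :=
  ∃ Fam : Set ((D.V →ₗ[ℝ] ℝ) × ℤ), (∀ q ∈ Fam, q.1 ∈ Γ.Delta) ∧
    Z = ⋂ q ∈ Fam, D.Dhalf q.1 q.2

/-- the enclosure `cl(Ω)` of a filter `Ω`: the filter of subsets containing an
intersection of half-apartments which is in `Ω` -/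
def encl (Ω : Filter D.V) : Filter D.V :=
  Filter.generate {Z | Z ∈ Ω ∧ Γ.IsEnclSet Z}

end KMGroupData

/-- The hovel `I = I(G,K)`: the quotient of `G(K) × 𝔸` by
`(g,x) ∼ (h,y) ⟺ ∃ n ∈ N(K), y = ν(n)x ∧ g⁻¹hn ∈ P̂_x`, presented abstractly as a
`G(K)`-set together with the embedding of the model apartment `𝔸`, the fixators
`P̂_x`, and the retraction `ρ` with center the negative fundamental sector-germ
`𝔖_{-∞}` onto the fundamental apartment. -/
structure HovelData (D : ApartmentData) (Γ : KMGroupData D) where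
  /-- the hovel -/
  Hov : Type
  [instAct : MulAction Γ.G Hov]
  /-- the embedding of the model apartment `𝔸 = V` -/
  emb : D.V → Hov
  emb_inj : Function.Injective emb
  /-- `N(K)` acts on the fundamental apartment through `ν` -/
  equivariant : ∀ n : Γ.N, ∀ v, (n : Γ.G) • emb v = emb (Γ.nu n v)
  /-- the parahoric-type "fixator" subgroups `P̂_x` -/
  Phat : D.V → Subgroup Γ.G
  /-- `P̂_x` is the fixator of `x` in `G(K)` -/
  stab_eq : ∀ x, MulAction.stabilizer Γ.G (emb x) = Phat x
  /-- the hovel is covered by the apartments `g · 𝔸` -/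
  covers : ∀ z : Hov, ∃ g : Γ.G, ∃ v, z = g • emb v
  /-- the retraction `ρ = ρ_{𝔸, 𝔖_{-∞}}` of the hovel onto the fundamental
  apartment, with center the negative fundamental sector-germ -/
  rho : Hov → D.V
  rho_emb : ∀ v, rho (emb v) = v
  /-- `ρ(z) = g·z` for some `g` in the fixator `H·U^-(K)` of `𝔖_{-∞}` -/
  rho_spec : ∀ z, ∃ g ∈ Γ.Hsub ⊔ Γ.Uminus, emb (rho z) = g • z

attribute [instance] HovelData.instAct

namespace HovelData

variable {D : ApartmentData} {Γ : KMGroupData D} (Hd : HovelData D Γ)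

/-- the apartment `g · 𝔸` of the hovel -/
def apt (g : Γ.G) : Set Hd.Hov := (fun z => g • z) '' Set.range Hd.emb

/-- the relation `x ≤ y` on the hovel: `x` and `y` lie in a common apartment `A`
and `y - x` belongs to the Tits cone of `A` -/
def hle (x y : Hd.Hov) : Prop :=
  ∃ g : Γ.G, ∃ a b : D.V, x = g • Hd.emb a ∧ y = g • Hd.emb b ∧ b - a ∈ D.Tits

/-- the fixator `G_Ω` of a filter `Ω` of subsets of `𝔸`: elements of `G(K)` fixing
pointwise some set of `Ω` -/
def Gfix (Ω : Filter D.V) : Subgroup Γ.G where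
  carrier := {g | ∃ S ∈ Ω, ∀ v ∈ S, g • Hd.emb v = Hd.emb v}
  one_mem' := ⟨Set.univ, Filter.univ_mem, fun v _ => one_smul _ _⟩
  mul_mem' := by
    rintro g h ⟨S, hS, hg⟩ ⟨S', hS', hh⟩
    exact ⟨S ∩ S', Filter.inter_mem hS hS', fun v hv => by
      rw [mul_smul, hh v hv.2, hg v hv.1]⟩
  inv_mem' := by
    rintro g ⟨S, hS, hg⟩
    refine ⟨S, hS, fun v hv => ?_⟩
    conv_lhs => rw [← hg v hv]
    rw [inv_smul_smul]

/-- the fixator `N̂_Ω` of `Ω` in `N(K)` -/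
def Nhat (Ω : Filter D.V) : Subgroup Γ.G := Hd.Gfix Ω ⊓ Γ.N

/-- `G(Ω ⊂ 𝔸)`: the elements `g ∈ G(K)` with `g · Ω ⊂ 𝔸` -/
def GinA (Ω : Filter D.V) : Set Γ.G :=
  {g | ∃ S ∈ Ω, ∀ v ∈ S, g • Hd.emb v ∈ Set.range Hd.emb}

/-- the property (GF+): `G_Ω = P̂_Ω = U_Ω^{pm+} · U_Ω^{nm-} · N̂_Ω` -/
def GFplus (Ω : Filter D.V) : Prop :=
  ((Hd.Gfix Ω : Set Γ.G) = (Γ.Upmp Ω : Set Γ.G) * (Γ.Unmm Ω : Set Γ.G) * (Hd.Nhat Ω : Set Γ.G))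

/-- the property (GF-): `G_Ω = P̂_Ω = U_Ω^{nm-} · U_Ω^{pm+} · N̂_Ω` -/
def GFminus (Ω : Filter D.V) : Prop :=
  ((Hd.Gfix Ω : Set Γ.G) = (Γ.Unmm Ω : Set Γ.G) * (Γ.Upmp Ω : Set Γ.G) * (Hd.Nhat Ω : Set Γ.G))

/-- the property (TF): `G(Ω ⊂ 𝔸) = N(K) · G_Ω` -/
def TF (Ω : Filter D.V) : Prop :=
  Hd.GinA Ω = (Γ.N : Set Γ.G) * (Hd.Gfix Ω : Set Γ.G)

/-- `Ω` has a good fixator -/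
def goodFix (Ω : Filter D.V) : Prop := Hd.GFplus Ω ∧ Hd.GFminus Ω ∧ Hd.TF Ω

/-- `Ω` has a half-good fixator -/
def halfGoodFix (Ω : Filter D.V) : Prop := Hd.TF Ω ∧ (Hd.GFplus Ω ∨ Hd.GFminus Ω)

end HovelData

namespace ApartmentData

variable (D : ApartmentData)

/-- the (relatively open) vectorial face `F^v(J)` -/
def coneFace (J : Set D.I) : Set D.V :=
  {u | (∀ i ∈ J, D.al i u = 0) ∧ ∀ i, i ∉ J → 0 < D.al i u}

/-- the closed vectorial face `F̄^v(J)` -/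
def coneFaceBar (J : Set D.I) : Set D.V :=
  {u | (∀ i ∈ J, D.al i u = 0) ∧ ∀ i, i ∉ J → 0 ≤ D.al i u}

/-- the vectorial face `± w · F^v(J)` (`sgn = true` for positive) -/
def vFace (w : D.V ≃ₗ[ℝ] D.V) (J : Set D.I) (sgn : Bool) : Set D.V :=
  {v | ∃ u ∈ D.coneFace J, v = (if sgn then (1:ℝ) else -1) • w u}

/-- the closed vectorial face `± w · F̄^v(J)` -/
def vFaceBar (w : D.V ≃ₗ[ℝ] D.V) (J : Set D.I) (sgn : Bool) : Set D.V :=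
  {v | ∃ u ∈ D.coneFaceBar J, v = (if sgn then (1:ℝ) else -1) • w u}

/-- the filter `germ_c(c + C)` of the germ at `c` of the cone `c + C`, generated by
the sets `(c + C) ∩ (c + ξ - C̄)` for `ξ ∈ C` -/
def germFil (c : D.V) (C CBar : Set D.V) : Filter D.V :=
  Filter.generate
    {S | ∃ ξ ∈ C, S = {v | ∃ u ∈ C, v = c + u} ∩ {v | ∃ u ∈ CBar, v = c + ξ - u}}

end ApartmentData

namespace KMGroupData

variable {D : ApartmentData} (Γ : KMGroupData D)

/-- `Z` is an intersection of closed or open half-apartments `D(α,k)`, `D°(α,k)`,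
`α ∈ Δ`, `k ∈ ℤ` -/
def IsMixedInter (Z : Set D.V) : Prop :=
  ∃ Fam : Set ((D.V →ₗ[ℝ] ℝ) × ℤ × Bool), (∀ q ∈ Fam, q.1 ∈ Γ.Delta) ∧
    Z = ⋂ q ∈ Fam, (if q.2.2 then D.Dhalf q.1 q.2.1 else {v | 0 < q.1 v + q.2.1})

/-- the face `F(x, F^v)` as a filter on `𝔸` (for `x = c`, cone data `C`, `C̄`):
subsets containing an intersection of (closed or open) half-apartments which
contains a set of the germ of `c + C` at `c` -/
def resFaceFil (c : D.V) (C CBar : Set D.V) : Filter D.V :=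
  Filter.generate {Z | Γ.IsMixedInter Z ∧ ∃ S ∈ D.germFil c C CBar, S ⊆ Z}

end KMGroupData

namespace HovelData

variable {D : ApartmentData} {Γ : KMGroupData D} (Hd : HovelData D Γ)

/-- the filter on the hovel which is the image of a filter on the model apartment
under `v ↦ h • emb v` -/
def pushFil (h : Γ.G) (F : Filter D.V) : Filter Hd.Hov :=
  Filter.map (fun v => h • Hd.emb v) F

/-- a filter on the hovel is contained in a subset -/
def filSub (F : Filter Hd.Hov) (A : Set Hd.Hov) : Prop := ∃ S ∈ F, S ⊆ A

/-- `p ∈ G(K)` fixes (pointwise) the filter `F` -/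
def fixesFil (p : Γ.G) (F : Filter Hd.Hov) : Prop := ∃ S ∈ F, ∀ z ∈ S, p • z = z

/-- the local chamber `germ_x(x ± w·C^v_f)` of the residue at `x = h • emb c`,
as a filter on the hovel -/
def chamFil (h : Γ.G) (c : D.V) (w : D.V ≃ₗ[ℝ] D.V) (sgn : Bool) : Filter Hd.Hov :=
  Hd.pushFil h (D.germFil c (D.vFace w ∅ sgn) (D.vFaceBar w ∅ sgn))

/-- `C` is a chamber of the (unrestricted) residue building `I_x^ε`
(`ε = +` for `sgn = true`) -/
def IsCham (x : Hd.Hov) (sgn : Bool) (C : Filter Hd.Hov) : Prop :=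
  ∃ h : Γ.G, ∃ c : D.V, ∃ w : D.V ≃ₗ[ℝ] D.V,
    x = h • Hd.emb c ∧ w ∈ D.W ∧ C = Hd.chamFil h c w sgn

/-- the `W^v`-distance between two chambers of `I_x^ε`: computed in a common
apartment via the identification with the model apartment -/
def distIs (sgn : Bool) (C C' : Filter Hd.Hov) (u : D.V ≃ₗ[ℝ] D.V) : Prop :=
  ∃ h : Γ.G, ∃ c : D.V, ∃ w₁ w₂ : D.V ≃ₗ[ℝ] D.V, w₁ ∈ D.W ∧ w₂ ∈ D.W ∧
    C = Hd.chamFil h c w₁ sgn ∧ C' = Hd.chamFil h c w₂ sgn ∧ u = w₁⁻¹ * w₂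

/-- the `W^v`-codistance `d_x^*` between chambers of `I_x^ε` and `I_x^{-ε}`:
`d_x^*(c,e) = w₁⁻¹w₂` if `c = germ_x(x + ε w₁ C_f^v)` and `e = germ_x(x - ε w₂ C_f^v)`
in a common apartment -/
def codistIs (sgn : Bool) (C E : Filter Hd.Hov) (u : D.V ≃ₗ[ℝ] D.V) : Prop :=
  ∃ h : Γ.G, ∃ c : D.V, ∃ w₁ w₂ : D.V ≃ₗ[ℝ] D.V, w₁ ∈ D.W ∧ w₂ ∈ D.W ∧
    C = Hd.chamFil h c w₁ sgn ∧ E = Hd.chamFil h c w₂ (!sgn) ∧ u = w₁⁻¹ * w₂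

end HovelData

namespace LSHecke

variable (D : ApartmentData)

lemma s_apply (i : D.I) (v : D.V) : D.s i v = v - D.al i v • D.alv i := rfl

lemma s_mul_s (i : D.I) : D.s i * D.s i = 1 := by
  ext v
  exact D.reflMap_invol (D.al i, D.alv i) (D.pairing_diag i) v

lemma s_inv (i : D.I) : (D.s i)⁻¹ = D.s i := inv_eq_of_mul_eq_one_left (s_mul_s D i)

lemma s_mem (i : D.I) : D.s i ∈ D.W := Subgroup.subset_closure ⟨i, rfl⟩

lemma wordProd_append (l l' : List D.I) :
    D.wordProd (l ++ l') = D.wordProd l * D.wordProd l' := by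
  simp [ApartmentData.wordProd]

lemma wordProd_cons (i : D.I) (l : List D.I) :
    D.wordProd (i :: l) = D.s i * D.wordProd l := by
  simp [ApartmentData.wordProd]

lemma wordProd_single (i : D.I) : D.wordProd [i] = D.s i := by
  simp [ApartmentData.wordProd]

lemma wordProd_nil : D.wordProd [] = 1 := by
  simp [ApartmentData.wordProd]

lemma wordProd_mem (l : List D.I) : D.wordProd l ∈ D.W := by
  induction l with
  | nil => rw [wordProd_nil]; exact one_mem _
  | cons i l ih => rw [wordProd_cons]; exact mul_mem (s_mem D i) ih

lemma exists_word {w : D.V ≃ₗ[ℝ] D.V} (hw : w ∈ D.W) : ∃ l, D.wordProd l = w := by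
  unfold ApartmentData.W at hw
  induction hw using Subgroup.closure_induction with
  | mem x hx => obtain ⟨i, rfl⟩ := hx; exact ⟨[i], wordProd_single D i⟩
  | one => exact ⟨[], wordProd_nil D⟩
  | mul x y _ _ hx hy =>
    obtain ⟨a, rfl⟩ := hx; obtain ⟨b, rfl⟩ := hy
    exact ⟨a ++ b, wordProd_append D a b⟩
  | inv x hxm hx =>
    obtain ⟨a, rfl⟩ := hx
    clear hxm
    refine ⟨a.reverse, ?_⟩
    induction a with
    | nil => simp [wordProd_nil]
    | cons i a ih =>
      rw [List.reverse_cons, wordProd_append, wordProd_cons D i a, ih, wordProd_single, mul_inv_rev,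
        s_inv]

lemma exists_reduced {w : D.V ≃ₗ[ℝ] D.V} (hw : w ∈ D.W) :
    ∃ l : List D.I, l.length = D.length w ∧ D.wordProd l = w := by
  obtain ⟨l, hl⟩ := exists_word D hw
  have : ({n | ∃ l : List D.I, l.length = n ∧ D.wordProd l = w} : Set ℕ).Nonempty :=
    ⟨l.length, l, rfl, hl⟩
  exact Nat.sInf_mem this

lemma length_le (l : List D.I) : D.length (D.wordProd l) ≤ l.length :=
  Nat.sInf_le ⟨l, rfl, rfl⟩

lemma length_mul_le {v : D.V ≃ₗ[ℝ] D.V} (hv : v ∈ D.W) (l : List D.I) :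
    D.length (v * D.wordProd l) ≤ D.length v + l.length := by
  obtain ⟨l0, h0, rfl⟩ := exists_reduced D hv
  rw [← wordProd_append, ← h0, ← List.length_append]
  exact length_le D _

/-- alternating word of length `k` ending with `j` -/
def altL {I : Type} : I → I → ℕ → List I
  | _, _, 0 => []
  | i, j, k + 1 => altL j i k ++ [j]

lemma altL_length {I : Type} (i j : I) (k : ℕ) : (altL i j k).length = k := by
  induction k generalizing i j with
  | zero => rfl
  | succ k ih => simp [altL, ih]

lemma altL_cons {I : Type} (i j : I) (k : ℕ) :
    altL i j (k + 1) = (if Even k then j else i) :: altL i j k := by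
  induction k generalizing i j with
  | zero => simp [altL]
  | succ k ih =>
    rw [altL, ih j i]
    conv_rhs => rw [altL]
    by_cases hk : Even k <;> simp [hk, Nat.even_add_one]

lemma altL_split {I : Type} (i j : I) (m k : ℕ) :
    ∃ X : List I, X.length = k ∧ altL i j (k + m) = X ++ altL i j m := by
  induction k with
  | zero => exact ⟨[], rfl, by simp⟩
  | succ k ih =>
    obtain ⟨X, hX, h⟩ := ih
    refine ⟨(if Even (k + m) then j else i) :: X, by simp [hX], ?_⟩
    rw [show k + 1 + m = (k + m) + 1 by ring, altL_cons, h, List.cons_append]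

/-- the finite rank two cases -/
def Fin2 (m : ℕ) (a b : ℝ) : Prop :=
  (m = 2 ∧ a = 0 ∧ b = 0) ∨ (m = 3 ∧ a = 1 ∧ b = 1) ∨ (m = 4 ∧ a = 1 ∧ b = 2) ∨
  (m = 4 ∧ a = 2 ∧ b = 1) ∨ (m = 6 ∧ a = 1 ∧ b = 3) ∨ (m = 6 ∧ a = 3 ∧ b = 1)

lemma Fin2.symm {m : ℕ} {a b : ℝ} (h : Fin2 m a b) : Fin2 m b a := by
  unfold Fin2 at *; tauto

lemma rank2_cases (i j : D.I) (hij : i ≠ j) :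
    4 ≤ (-D.al i (D.alv j)) * (-D.al j (D.alv i)) ∨
      ∃ m, Fin2 m (-D.al i (D.alv j)) (-D.al j (D.alv i)) := by
  obtain ⟨x, hx⟩ := D.pairing_int j i
  obtain ⟨y, hy⟩ := D.pairing_int i j
  have hx0 := D.pairing_offdiag j i hij.symm
  have hy0 := D.pairing_offdiag i j hij
  have hz := D.pairing_zero_iff i j
  rw [hx, hy] at *
  have hx0' : x ≤ 0 := by exact_mod_cast hx0
  have hy0' : y ≤ 0 := by exact_mod_cast hy0
  have hz' : y = 0 ↔ x = 0 := by exact_mod_cast hz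
  by_cases h4 : 4 ≤ (-x) * (-y)
  · left; exact_mod_cast h4
  right
  by_cases hxz : x = 0
  · have := hz'.2 hxz
    subst hxz this
    exact ⟨2, by simp [Fin2]⟩
  have hyz : y ≠ 0 := fun h => hxz (hz'.1 h)
  have h1 : x ≤ -1 := by omega
  have h2 : y ≤ -1 := by omega
  have h3 : -3 ≤ x := by nlinarith
  have h3' : -3 ≤ y := by nlinarith
  have : (x = -1 ∧ y = -1) ∨ (x = -1 ∧ y = -2) ∨ (x = -2 ∧ y = -1) ∨ (x = -1 ∧ y = -3) ∨
      (x = -3 ∧ y = -1) := by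
    interval_cases x <;> interval_cases y <;> simp_all
  rcases this with ⟨rfl, rfl⟩ | ⟨rfl, rfl⟩ | ⟨rfl, rfl⟩ | ⟨rfl, rfl⟩ | ⟨rfl, rfl⟩
  · exact ⟨3, by simp [Fin2]⟩
  · exact ⟨4, by simp [Fin2]⟩
  · exact ⟨4, by simp [Fin2]⟩
  · exact ⟨6, by simp [Fin2]⟩
  · exact ⟨6, by simp [Fin2]⟩

lemma s_comb_left (i j : D.I) (v : D.V) (p q : ℝ) :
    D.s i (v + p • D.alv i + q • D.alv j) =
      v + (-p - D.al i v - q * D.al i (D.alv j)) • D.alv i + q • D.alv j := by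
  rw [s_apply]
  simp only [map_add, map_smul, smul_eq_mul, D.pairing_diag]
  module

lemma s_comb_right (i j : D.I) (v : D.V) (p q : ℝ) :
    D.s j (v + p • D.alv i + q • D.alv j) =
      v + p • D.alv i + (-q - D.al j v - p * D.al j (D.alv i)) • D.alv j := by
  rw [s_apply]
  simp only [map_add, map_smul, smul_eq_mul, D.pairing_diag]
  module

lemma braid (i j : D.I) (m : ℕ)
    (h : Fin2 m (-D.al i (D.alv j)) (-D.al j (D.alv i))) :
    D.wordProd (altL i j m) = D.wordProd (altL j i m) := by
  ext v
  have hv : v = v + (0:ℝ) • D.alv i + (0:ℝ) • D.alv j := by simp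
  rw [hv]
  rcases h with ⟨rfl, ha, hb⟩ | ⟨rfl, ha, hb⟩ | ⟨rfl, ha, hb⟩ | ⟨rfl, ha, hb⟩ | ⟨rfl, ha, hb⟩ |
    ⟨rfl, ha, hb⟩ <;>
  · have ha' := neg_eq_iff_eq_neg.1 ha
    have hb' := neg_eq_iff_eq_neg.1 hb
    simp only [altL, List.nil_append, List.cons_append, wordProd_cons, wordProd_nil,
      LinearEquiv.mul_apply, LinearEquiv.coe_one, id_eq, s_comb_left, s_comb_right, ha', hb']
    module

section Rep

variable {D}
variable {M : Type} [AddCommGroup M] [Module ℝ M]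

/-- the cone generated by a family -/
def Cone {I : Type} [Fintype I] (e : I → M) (x : M) : Prop :=
  ∃ n : I → ℝ, (∀ i, 0 ≤ n i) ∧ x = ∑ i, n i • e i

lemma Cone.add {I : Type} [Fintype I] {e : I → M} {x y : M} (hx : Cone e x) (hy : Cone e y) :
    Cone e (x + y) := by
  obtain ⟨n, hn, rfl⟩ := hx
  obtain ⟨m, hm, rfl⟩ := hy
  exact ⟨fun i => n i + m i, fun i => add_nonneg (hn i) (hm i), by
    simp [add_smul, Finset.sum_add_distrib]⟩

lemma Cone.smul {I : Type} [Fintype I] {e : I → M} {x : M} {c : ℝ} (hc : 0 ≤ c)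
    (hx : Cone e x) : Cone e (c • x) := by
  obtain ⟨n, hn, rfl⟩ := hx
  exact ⟨fun i => c * n i, fun i => mul_nonneg hc (hn i), by
    simp [mul_smul, Finset.smul_sum]⟩

lemma Cone.single {I : Type} [Fintype I] (e : I → M) (i : I) : Cone e (e i) := by
  classical
  exact ⟨fun k => if k = i then 1 else 0, fun k => by dsimp; split_ifs <;> norm_num, by simp⟩

lemma Cone.zero {I : Type} [Fintype I] (e : I → M) : Cone e 0 :=
  ⟨fun _ => 0, fun _ => le_rfl, by simp⟩

lemma Cone.antisymm {I : Type} [Fintype I] {e : I → M} (he : LinearIndependent ℝ e) {x : M}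
    (hx : Cone e x) (hy : Cone e (-x)) : x = 0 := by
  obtain ⟨n, hn, h1⟩ := hx
  obtain ⟨m, hm, h2⟩ := hy
  have h3 : ∑ i, (n i + m i) • e i = 0 := by
    simp only [add_smul, Finset.sum_add_distrib, ← h1, ← h2, add_neg_cancel]
  have h4 := Fintype.linearIndependent_iff.1 he _ h3
  rw [h1]
  refine Finset.sum_eq_zero fun i _ => ?_
  have : n i = 0 := by linarith [h4 i, hn i, hm i]
  simp [this]

/-- if `x` and `-(x - c e_i)` lie in the cone then `x` is a multiple of `e_i` -/
lemma Cone.extremal {I : Type} [Fintype I] {e : I → M} (he : LinearIndependent ℝ e) {x : M}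
    (i : I) (c : ℝ) (hx : Cone e x) (hy : Cone e (-(x - c • e i))) : ∃ d : ℝ, x = d • e i := by
  classical
  obtain ⟨n, hn, h1⟩ := hx
  obtain ⟨m, hm, h2⟩ := hy
  have h3 : ∑ k, (n k + m k - (if k = i then c else 0)) • e k = 0 := by
    simp only [add_smul, sub_smul, Finset.sum_add_distrib, Finset.sum_sub_distrib, ← h1, ← h2]
    simp
  have h4 := Fintype.linearIndependent_iff.1 he _ h3
  refine ⟨n i, ?_⟩
  rw [h1]
  refine Finset.sum_eq_single i (fun k _ hk => ?_) (fun h => absurd (Finset.mem_univ i) h)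
  have h5 := h4 k
  rw [if_neg hk] at h5
  have : n k = 0 := by linarith [hn k, hm k]
  simp [this]

variable (ρ : (D.V ≃ₗ[ℝ] D.V) →* Module.End ℝ M) (e : D.I → M) (B : D.I → D.I → ℝ)
variable (hdiag : ∀ i, ρ (D.s i) (e i) = -e i)
variable (hoff : ∀ i j, i ≠ j → ρ (D.s j) (e i) = e i + B i j • e j)

include hdiag hoff in
lemma alt_rec (i j : D.I) (hij : i ≠ j) (k : ℕ) :
    ρ (D.wordProd (altL i j (k + 2))) (e i) =
      B i j • ρ (D.wordProd (altL j i (k + 1))) (e j) - ρ (D.wordProd (altL i j k)) (e i) := by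
  have h1 : ρ (D.wordProd (altL i j (k + 2))) (e i) =
      ρ (D.wordProd (altL j i (k + 1))) (e i) +
        B i j • ρ (D.wordProd (altL j i (k + 1))) (e j) := by
    rw [altL, wordProd_append, wordProd_single, map_mul, Module.End.mul_apply, hoff i j hij,
      map_add, map_smul]
  have h2 : ρ (D.wordProd (altL j i (k + 1))) (e i) = - ρ (D.wordProd (altL i j k)) (e i) := by
    rw [altL, wordProd_append, wordProd_single, map_mul, Module.End.mul_apply, hdiag, map_neg]
  rw [h1, h2]
  abel

include hoff in
lemma alt_one (i j : D.I) (hij : i ≠ j) :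
    ρ (D.wordProd (altL i j 1)) (e i) = e i + B i j • e j := by
  simp [altL, wordProd_single, hoff i j hij]

lemma alt_zero (i j : D.I) : ρ (D.wordProd (altL i j 0)) (e i) = e i := by
  simp [altL, wordProd_nil]

include hdiag hoff in
lemma alt_inf (v : D.V ≃ₗ[ℝ] D.V) (i j : D.I) (hij : i ≠ j) (h0 : 0 ≤ B i j) (h0' : 0 ≤ B j i)
    (h4 : 4 ≤ B i j * B j i) (hi : Cone e (ρ v (e i))) (hj : Cone e (ρ v (e j))) (k : ℕ) :
    Cone e (ρ v (ρ (D.wordProd (altL i j k)) (e i))) := by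
  set F : ℕ → M := fun k => ρ v (ρ (D.wordProd (altL i j k)) (e i)) with hF
  set G : ℕ → M := fun k => ρ v (ρ (D.wordProd (altL j i k)) (e j)) with hG
  have hF0 : F 0 = ρ v (e i) := by simp only [hF]; rw [alt_zero]
  have hG0 : G 0 = ρ v (e j) := by simp only [hG]; rw [alt_zero]
  have hF1 : F 1 = ρ v (e i) + B i j • ρ v (e j) := by
    simp only [hF]; rw [alt_one ρ e B hoff i j hij, map_add, map_smul]
  have hG1 : G 1 = ρ v (e j) + B j i • ρ v (e i) := by
    simp only [hG]; rw [alt_one ρ e B hoff j i hij.symm, map_add, map_smul]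
  have hFr : ∀ k, F (k + 2) = B i j • G (k + 1) - F k := by
    intro k
    simp only [hF, hG]; rw [alt_rec ρ e B hdiag hoff i j hij, map_sub, map_smul]
  have hGr : ∀ k, G (k + 2) = B j i • F (k + 1) - G k := by
    intro k
    simp only [hF, hG]; rw [alt_rec ρ e B hdiag hoff j i hij.symm, map_sub, map_smul]
  have main : ∀ k, Cone e (F k) ∧ Cone e (G k) ∧
      Cone e ((2:ℝ) • F (k + 1) - B i j • G k) ∧ Cone e ((2:ℝ) • G (k + 1) - B j i • F k) := by
    intro k
    induction k with
    | zero =>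
      refine ⟨by rwa [hF0], by rwa [hG0], ?_, ?_⟩
      · have := (hi.smul (by norm_num : (0:ℝ) ≤ 2)).add (hj.smul h0)
        convert this using 1
        simp only [zero_add, hF1, hG0]; module
      · have := (hj.smul (by norm_num : (0:ℝ) ≤ 2)).add (hi.smul h0')
        convert this using 1
        simp only [zero_add, hG1, hF0]; module
    | succ k ih =>
      obtain ⟨c1, c2, c3, c4⟩ := ih
      refine ⟨?_, ?_, ?_, ?_⟩
      · have := (c3.add (c2.smul h0)).smul (by norm_num : (0:ℝ) ≤ 1 / 2)
        convert this using 1; module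
      · have := (c4.add (c1.smul h0')).smul (by norm_num : (0:ℝ) ≤ 1 / 2)
        convert this using 1; module
      · have := (c4.smul (by positivity : 0 ≤ B i j / 2)).add
          (c1.smul (by linarith : 0 ≤ (B i j * B j i - 4) / 2))
        convert this using 1
        rw [hFr]; module
      · have := (c3.smul (by positivity : 0 ≤ B j i / 2)).add
          (c2.smul (by linarith : 0 ≤ (B i j * B j i - 4) / 2))
        convert this using 1
        rw [hGr]; module
  exact (main k).1

include hdiag hoff in
lemma alt_fin (v : D.V ≃ₗ[ℝ] D.V) (i j : D.I) (hij : i ≠ j) (m : ℕ) (h : Fin2 m (B i j) (B j i))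
    (hi : Cone e (ρ v (e i))) (hj : Cone e (ρ v (e j))) (k : ℕ) (hk : k < m) :
    Cone e (ρ v (ρ (D.wordProd (altL i j k)) (e i))) := by
  set F : ℕ → M := fun k => ρ v (ρ (D.wordProd (altL i j k)) (e i)) with hF
  set G : ℕ → M := fun k => ρ v (ρ (D.wordProd (altL j i k)) (e j)) with hG
  have hF0 : F 0 = ρ v (e i) := by simp only [hF]; rw [alt_zero]
  have hG0 : G 0 = ρ v (e j) := by simp only [hG]; rw [alt_zero]
  have hF1 : F 1 = ρ v (e i) + B i j • ρ v (e j) := by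
    simp only [hF]; rw [alt_one ρ e B hoff i j hij, map_add, map_smul]
  have hG1 : G 1 = ρ v (e j) + B j i • ρ v (e i) := by
    simp only [hG]; rw [alt_one ρ e B hoff j i hij.symm, map_add, map_smul]
  have hFr : ∀ k, F (k + 2) = B i j • G (k + 1) - F k := by
    intro k
    simp only [hF, hG]; rw [alt_rec ρ e B hdiag hoff i j hij, map_sub, map_smul]
  have hGr : ∀ k, G (k + 2) = B j i • F (k + 1) - G k := by
    intro k
    simp only [hF, hG]; rw [alt_rec ρ e B hdiag hoff j i hij.symm, map_sub, map_smul]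
  have hF2 := hFr 0
  have hG2 := hGr 0
  have hF3 := hFr 1
  have hG3 := hGr 1
  have hF4 := hFr 2
  have hG4 := hGr 2
  have hF5 := hFr 3
  norm_num at hF2 hG2 hF3 hG3 hF4 hG4 hF5
  have key : ∀ p q : ℝ, 0 ≤ p → 0 ≤ q → F k = p • ρ v (e i) + q • ρ v (e j) → Cone e (F k) := by
    intro p q hp hq hpq
    rw [hpq]
    exact (hi.smul hp).add (hj.smul hq)
  change Cone e (F k)
  clear_value F G
  have hFf : F k = (match k with
      | 0 => 1 | 1 => 1 | 2 => B i j * B j i - 1 | 3 => B i j * B j i - 1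
      | _ => (B i j * B j i) ^ 2 - 3 * (B i j * B j i) + 1 : ℝ) • ρ v (e i) +
      (match k with
      | 0 => 0 | 1 => B i j | 2 => B i j | 3 => B i j * (B i j * B j i - 2)
      | 4 => B i j * (B i j * B j i - 2)
      | _ => B i j * ((B i j * B j i) ^ 2 - 4 * (B i j * B j i) + 3) : ℝ) • ρ v (e j) := by
    have hk6 : k < 6 := by
      rcases h with h | h | h | h | h | h <;> omega
    interval_cases k <;> simp only [hF5, hF4, hG4, hF3, hG3, hF2, hG2, hF1, hG1, hF0, hG0] <;>
      module
  refine key _ _ ?_ ?_ hFf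
  · rcases h with ⟨rfl, ha, hb⟩ | ⟨rfl, ha, hb⟩ | ⟨rfl, ha, hb⟩ | ⟨rfl, ha, hb⟩ | ⟨rfl, ha, hb⟩ |
      ⟨rfl, ha, hb⟩ <;> rw [ha, hb] <;> interval_cases k <;> norm_num
  · rcases h with ⟨rfl, ha, hb⟩ | ⟨rfl, ha, hb⟩ | ⟨rfl, ha, hb⟩ | ⟨rfl, ha, hb⟩ | ⟨rfl, ha, hb⟩ |
      ⟨rfl, ha, hb⟩ <;> rw [ha, hb] <;> interval_cases k <;> norm_num

include hdiag hoff in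
/-- if `ℓ(w) ≤ ℓ(w s_i)` then `w e_i` is in the positive cone -/
theorem pos_of_length (h0 : ∀ i j, i ≠ j → 0 ≤ B i j)
    (hB : ∀ i j, i ≠ j → 4 ≤ B i j * B j i ∨ ∃ m, Fin2 m (B i j) (B j i) ∧
      D.wordProd (altL i j m) = D.wordProd (altL j i m))
    (n : ℕ) : ∀ w ∈ D.W, D.length w = n → ∀ i, D.length w ≤ D.length (w * D.s i) →
      Cone e (ρ w (e i)) := by
  induction n using Nat.strong_induction_on with
  | _ n ih =>
  intro w hw hwn i hi
  rcases Nat.eq_zero_or_pos n with hn | hn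
  · obtain ⟨l, hl, rfl⟩ := exists_reduced D hw
    have : l = [] := List.length_eq_zero_iff.1 (by omega)
    subst this
    rw [wordProd_nil, map_one]
    exact Cone.single e i
  -- a reduced word of `w` ends with some `j ≠ i`
  obtain ⟨j, hij, v1, hv1, hwv1, hl1⟩ : ∃ j, i ≠ j ∧ ∃ v ∈ D.W, w = v * D.wordProd (altL i j 1) ∧
      D.length w = D.length v + 1 := by
    obtain ⟨l, hl, rfl⟩ := exists_reduced D hw
    rcases List.eq_nil_or_concat l with rfl | ⟨l', j, rfl⟩
    · simp at hl; omega
    rw [List.concat_eq_append] at *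
    have e1 : D.wordProd (l' ++ [j]) = D.wordProd l' * D.s j := by
      rw [wordProd_append, wordProd_single]
    have a1 := length_le D l'
    have a2 := length_mul_le D (wordProd_mem D l') [j]
    rw [wordProd_single, ← e1] at a2
    simp only [List.length_append, List.length_cons, List.length_nil] at hl a2
    refine ⟨j, ?_, D.wordProd l', wordProd_mem D l', ?_, by simp at a2 ⊢; omega⟩
    · rintro rfl
      have e2 : D.wordProd (l' ++ [i]) * D.s i = D.wordProd l' := by
        rw [e1, mul_assoc, s_mul_s, mul_one]
      rw [e2] at hi
      omega
    · simp [altL, wordProd_append]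
  -- maximal alternating tail
  let Pk : ℕ → Prop := fun k => ∃ v ∈ D.W, w = v * D.wordProd (altL i j k) ∧
    D.length w = D.length v + k
  classical
  have hP1 : Pk 1 := ⟨v1, hv1, hwv1, hl1⟩
  have hbd : 1 ≤ n := hn
  set k := Nat.findGreatest Pk n with hk
  have hPk : Pk k := Nat.findGreatest_spec hbd hP1
  have hk1 : 1 ≤ k := Nat.le_findGreatest hbd hP1
  obtain ⟨v, hv, hwv, hlv⟩ := hPk
  have hnP : ¬ Pk (k + 1) := by
    intro h
    have h' := h
    obtain ⟨v', -, -, h2⟩ := h'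
    have := Nat.le_findGreatest (m := k + 1) (n := n) (by omega) h
    omega
  -- first letter of tail
  clear_value k
  obtain ⟨k', rfl⟩ : ∃ k', k = k' + 1 := ⟨k - 1, by omega⟩
  have hc : D.length v ≤ D.length (v * D.s (if Even k' then j else i)) := by
    have h1 : w = (v * D.s (if Even k' then j else i)) * D.wordProd (altL i j k') := by
      rw [hwv, altL_cons, wordProd_cons, mul_assoc]
    have h2 := length_mul_le D (mul_mem hv (s_mem D (if Even k' then j else i))) (altL i j k')
    rw [← h1, altL_length] at h2
    omega
  have hd : D.length v ≤ D.length (v * D.s (if Even (k' + 1) then j else i)) := by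
    by_contra hlt
    push Not at hlt
    apply hnP
    set d := (if Even (k' + 1) then j else i) with hdd
    have h3 : (v * D.s d) * D.s d = v := by rw [mul_assoc, s_mul_s, mul_one]
    refine ⟨v * D.s d, mul_mem hv (s_mem D d), ?_, ?_⟩
    · rw [altL_cons, wordProd_cons, ← hdd, ← mul_assoc, h3]; exact hwv
    · have := length_mul_le D (mul_mem hv (s_mem D d)) [d]
      rw [wordProd_single, h3] at this
      simp at this
      omega
  have hvi : Cone e (ρ v (e i)) := by
    refine ih _ (by omega) v hv rfl i ?_
    by_cases hp : Even k'
    · simpa [hp, Nat.even_add_one] using hd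
    · simpa [hp] using hc
  have hvj : Cone e (ρ v (e j)) := by
    refine ih _ (by omega) v hv rfl j ?_
    by_cases hp : Even k'
    · simpa [hp] using hc
    · simpa [hp, Nat.even_add_one] using hd
  have hgoal : ρ w (e i) = ρ v (ρ (D.wordProd (altL i j (k' + 1))) (e i)) := by
    conv_lhs => rw [hwv]
    rw [map_mul, Module.End.mul_apply]
  rw [hgoal]
  rcases hB i j hij with h4 | ⟨m, hm, hbr⟩
  · exact alt_inf ρ e B hdiag hoff v i j hij (h0 i j hij) (h0 j i hij.symm) h4 hvi hvj _
  · by_cases hkm : k' + 1 < m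
    · exact alt_fin ρ e B hdiag hoff v i j hij m hm hvi hvj _ hkm
    · exfalso
      have hm0 : 1 ≤ m := by rcases hm with h | h | h | h | h | h <;> omega
      obtain ⟨m', rfl⟩ : ∃ m', m = m' + 1 := ⟨m - 1, by omega⟩
      obtain ⟨X, hX, hs⟩ := altL_split i j (m' + 1) (k' + 1 - (m' + 1))
      rw [show k' + 1 - (m' + 1) + (m' + 1) = k' + 1 by omega] at hs
      have h5 : w * D.s i = v * D.wordProd (X ++ altL i j m') := by
        rw [hwv, hs, wordProd_append, hbr, altL, wordProd_append, wordProd_append, wordProd_single]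
        simp only [mul_assoc, s_mul_s, mul_one]
      have h6 := length_mul_le D hv (X ++ altL i j m')
      rw [← h5, List.length_append, altL_length, hX] at h6
      omega

end Rep

/-- action on linear forms -/
def rootRep : (D.V ≃ₗ[ℝ] D.V) →* Module.End ℝ (D.V →ₗ[ℝ] ℝ) where
  toFun w :=
    { toFun := fun φ => φ.comp (w.symm : D.V →ₗ[ℝ] D.V)
      map_add' := fun φ ψ => rfl
      map_smul' := fun c φ => rfl }
  map_one' := rfl
  map_mul' := fun x y => rfl

/-- action on vectors -/
def corootRep : (D.V ≃ₗ[ℝ] D.V) →* Module.End ℝ D.V where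
  toFun w := (w : D.V →ₗ[ℝ] D.V)
  map_one' := rfl
  map_mul' := fun x y => rfl

lemma s_symm (i : D.I) : (D.s i).symm = D.s i := s_inv D i

theorem root_pos {w : D.V ≃ₗ[ℝ] D.V} (hw : w ∈ D.W) (i : D.I)
    (h : D.length w ≤ D.length (w * D.s i)) :
    Cone D.al ((D.al i).comp (w.symm : D.V →ₗ[ℝ] D.V)) ∧ Cone D.alv (w (D.alv i)) := by
  constructor
  · refine pos_of_length (rootRep D) D.al (fun i j => -D.al i (D.alv j)) ?_ ?_ ?_ ?_ _ w hw rfl i h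
    · intro i
      ext v
      change D.al i ((D.s i).symm v) = - D.al i v
      rw [s_symm, s_apply]; simp [D.pairing_diag]; ring
    · intro i j _
      ext v
      change D.al i ((D.s j).symm v) = D.al i v + (-D.al i (D.alv j)) * D.al j v
      rw [s_symm, s_apply]; simp; ring
    · intro i j hij
      have := D.pairing_offdiag j i hij.symm
      linarith
    · intro i j hij
      rcases rank2_cases D i j hij with h | ⟨m, h⟩
      · exact Or.inl h
      · exact Or.inr ⟨m, h, braid D i j m h⟩
  · refine pos_of_length (corootRep D) D.alv (fun i j => -D.al j (D.alv i)) ?_ ?_ ?_ ?_ _ w hw rfl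
      i h
    · intro i
      change D.s i (D.alv i) = _
      rw [s_apply, D.pairing_diag]; module
    · intro i j _
      change D.s j (D.alv i) = _
      rw [s_apply]; module
    · intro i j hij
      have := D.pairing_offdiag i j hij
      linarith
    · intro i j hij
      rcases rank2_cases D i j hij with h | ⟨m, h⟩
      · left; linarith
      · exact Or.inr ⟨m, h.symm, braid D i j m h⟩

/-- positivity of a (root, coroot) pair -/
def Pos (p : (D.V →ₗ[ℝ] ℝ) × D.V) : Prop := Cone D.al p.1 ∧ Cone D.alv p.2

/-- the action on pairs -/
def act (w : D.V ≃ₗ[ℝ] D.V) (p : (D.V →ₗ[ℝ] ℝ) × D.V) : (D.V →ₗ[ℝ] ℝ) × D.V :=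
  (p.1.comp (w.symm : D.V →ₗ[ℝ] D.V), w p.2)

lemma act_mul (w w' : D.V ≃ₗ[ℝ] D.V) (p : (D.V →ₗ[ℝ] ℝ) × D.V) :
    act D (w * w') p = act D w (act D w' p) := rfl

lemma act_mem {w : D.V ≃ₗ[ℝ] D.V} (hw : w ∈ D.W) {p : (D.V →ₗ[ℝ] ℝ) × D.V} (hp : p ∈ D.Phi) :
    act D w p ∈ D.Phi := by
  obtain ⟨u, hu, i, h1, h2⟩ := hp
  refine ⟨w * u, mul_mem hw hu, i, ?_, ?_⟩
  · simp only [act]; rw [h1]; rfl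
  · simp only [act]; rw [h2]; rfl

lemma pos_or_neg {p : (D.V →ₗ[ℝ] ℝ) × D.V} (hp : p ∈ D.Phi) :
    Pos D p ∨ Pos D (D.negP p) := by
  obtain ⟨w, hw, i, h1, h2⟩ := hp
  rcases le_total (D.length w) (D.length (w * D.s i)) with h | h
  · left
    have := root_pos D hw i h
    rw [← h1, ← h2] at this
    exact this
  · right
    have h' : D.length (w * D.s i) ≤ D.length ((w * D.s i) * D.s i) := by
      rwa [mul_assoc, s_mul_s, mul_one]
    have := root_pos D (mul_mem hw (s_mem D i)) i h'
    unfold Pos ApartmentData.negP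
    convert this using 2
    · rw [h1]; ext v
      change -(D.al i (w.symm v)) = D.al i ((D.s i).symm (w.symm v))
      rw [s_symm, s_apply]; simp [D.pairing_diag]; ring
    · rw [h2]
      change -(w (D.alv i)) = w (D.s i (D.alv i))
      rw [s_apply, D.pairing_diag, ← map_neg]
      congr 1; module

lemma not_both {p : (D.V →ₗ[ℝ] ℝ) × D.V} (hp : p ∈ D.Phi) (h1 : Cone D.al p.1)
    (h2 : Cone D.al (-p.1)) : False := by
  have h := Cone.antisymm D.free_al h1 h2
  have := D.phi_two hp
  rw [h] at this
  simp at this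

lemma pos_of_PhiPos {p : (D.V →ₗ[ℝ] ℝ) × D.V} (hp : p ∈ D.PhiPos) : Pos D p := by
  obtain ⟨hp, n, hn⟩ := hp
  rcases pos_or_neg D hp with h | h
  · exact h
  · exact (not_both D hp ⟨fun i => n i, fun i => Nat.cast_nonneg _, hn⟩ h.1).elim

lemma refl_conj (w : D.V ≃ₗ[ℝ] D.V) (p : (D.V →ₗ[ℝ] ℝ) × D.V) (v : D.V) :
    D.reflMap (act D w p) (w v) = w (D.reflMap p v) := by
  simp [ApartmentData.reflMap, act]

/-- strong exchange -/
lemma exchange (l : List D.I) : ∀ p ∈ D.Phi, Pos D p →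
    Pos D (D.negP (act D (D.wordProd l)⁻¹ p)) →
    ∃ l' : List D.I, l'.length + 1 = l.length ∧
      ∀ v, D.wordProd l' v = D.reflMap p (D.wordProd l v) := by
  induction l with
  | nil =>
    intro p hp h1 h2
    rw [wordProd_nil, inv_one] at h2
    exact (not_both D hp h1.1 h2.1).elim
  | cons i l ih =>
    intro p hp h1 h2
    rw [wordProd_cons, mul_inv_rev, s_inv, act_mul] at h2
    have hp' := act_mem D (s_mem D i) hp
    rcases pos_or_neg D hp' with h | h
    · obtain ⟨l', hl', h'⟩ := ih _ hp' h h2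
      refine ⟨i :: l', by simp [hl'], fun v => ?_⟩
      rw [wordProd_cons, wordProd_cons, LinearEquiv.mul_apply, LinearEquiv.mul_apply, h',
        ← refl_conj, ← act_mul, s_mul_s]
      rfl
    · refine ⟨l, by simp, fun v => ?_⟩
      have e1 : (act D (D.s i) p).1 = p.1 - p.1 (D.alv i) • D.al i := by
        ext v
        change p.1 ((D.s i).symm v) = p.1 v - p.1 (D.alv i) * D.al i v
        rw [s_symm, s_apply]; simp; ring
      have e2 : (act D (D.s i) p).2 = p.2 - D.al i p.2 • D.alv i := rfl
      obtain ⟨ha, hb⟩ := h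
      simp only [ApartmentData.negP] at ha hb
      rw [e1] at ha
      rw [e2] at hb
      obtain ⟨c, hc⟩ := Cone.extremal D.free_al i _ h1.1 ha
      obtain ⟨d, hd⟩ := Cone.extremal D.free_alv i _ h1.2 hb
      have h2' := D.phi_two hp
      rw [hc, hd] at h2'
      simp [D.pairing_diag] at h2'
      have hcd : c * d = 1 := by linarith
      have hr : ∀ v, D.reflMap p v = D.s i v := by
        intro v
        rw [s_apply]
        simp only [ApartmentData.reflMap, LinearMap.sub_apply, LinearMap.id_apply,
          LinearMap.smulRight_apply, hc, hd, LinearMap.smul_apply, smul_smul, smul_eq_mul]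
        congr 2
        linear_combination (D.al i v) * hcd
      rw [hr, wordProd_cons, ← LinearEquiv.mul_apply, ← mul_assoc, s_mul_s, one_mul]

lemma length_lt {w u : D.V ≃ₗ[ℝ] D.V} (hw : w ∈ D.W) {p : (D.V →ₗ[ℝ] ℝ) × D.V} (hp : p ∈ D.Phi)
    (hpos : Pos D p) (hneg : Pos D (D.negP (act D w⁻¹ p))) (hu : ∀ v, u v = D.reflMap p (w v)) :
    D.length u < D.length w := by
  obtain ⟨l, hl, rfl⟩ := exists_reduced D hw
  obtain ⟨l', hl', h⟩ := exchange D l p hp hpos hneg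
  have : u = D.wordProd l' := by ext v; rw [hu, h]
  have h3 := length_le D l'
  rw [← this] at h3
  omega

lemma cone_nonneg {lam : D.V} (hdom : D.isDominant lam) {φ : D.V →ₗ[ℝ] ℝ} (h : Cone D.al φ) :
    0 ≤ φ lam := by
  obtain ⟨n, hn, rfl⟩ := h
  rw [LinearMap.sum_apply]
  exact Finset.sum_nonneg fun i _ => mul_nonneg (hn i) (hdom i)

lemma act_inv_apply (w : D.V ≃ₗ[ℝ] D.V) (p : (D.V →ₗ[ℝ] ℝ) × D.V) (v : D.V) :
    (act D w⁻¹ p).1 v = p.1 (w v) := rfl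

/-- negative pairing gives a Bruhat step -/
lemma cov_of_neg {lam : D.V} (hdom : D.isDominant lam) {w u : D.V ≃ₗ[ℝ] D.V} (hw : w ∈ D.W)
    {p : (D.V →ₗ[ℝ] ℝ) × D.V} (hp : p ∈ D.PhiPos) (hu : ∀ v, u v = D.reflMap p (w v))
    (hneg : p.1 (w lam) < 0) : D.bruhatCov u w := by
  refine ⟨⟨D.reflEquiv p (D.phi_two hp.1), ⟨p, hp.1, fun v => rfl⟩, ?_⟩, ?_⟩
  · ext v
    change w v = D.reflMap p (u v)
    rw [hu, D.reflMap_invol p (D.phi_two hp.1)]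
  · refine length_lt D hw hp.1 (pos_of_PhiPos D hp) ?_ hu
    rcases pos_or_neg D (act_mem D (inv_mem hw) hp.1) with h | h
    · have := cone_nonneg D hdom h.1
      rw [act_inv_apply] at this
      linarith
    · exact h

lemma reflMap_negP (p : (D.V →ₗ[ℝ] ℝ) × D.V) (v : D.V) :
    D.reflMap (D.negP p) v = D.reflMap p v := by
  simp [ApartmentData.reflMap, ApartmentData.negP]

lemma negP_mem {p : (D.V →ₗ[ℝ] ℝ) × D.V} (hp : p ∈ D.Phi) : D.negP p ∈ D.Phi := by
  obtain ⟨w, hw, i, h1, h2⟩ := hp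
  refine ⟨w * D.s i, mul_mem hw (s_mem D i), i, ?_, ?_⟩
  · simp only [ApartmentData.negP]; rw [h1]; ext v
    change -(D.al i (w.symm v)) = D.al i ((D.s i).symm (w.symm v))
    rw [s_symm, s_apply]; simp [D.pairing_diag]; ring
  · simp only [ApartmentData.negP]; rw [h2]
    change -(w (D.alv i)) = w (D.s i (D.alv i))
    rw [s_apply, D.pairing_diag, ← map_neg]
    congr 1; module

lemma refl_mem {p : (D.V →ₗ[ℝ] ℝ) × D.V} (hp : p ∈ D.Phi) {t : D.V ≃ₗ[ℝ] D.V}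
    (ht : ∀ v, t v = D.reflMap p v) : t ∈ D.W := by
  obtain ⟨w, hw, i, h1, h2⟩ := hp
  have : t = w * D.s i * w⁻¹ := by
    ext v
    rw [ht]
    have h3 : p = act D w (D.al i, D.alv i) := Prod.ext h1 h2
    have h4 := refl_conj D w (D.al i, D.alv i) (w⁻¹ v)
    rw [← h3] at h4
    have h5 : w (w⁻¹ v) = v := w.apply_symm_apply v
    rw [h5] at h4
    exact h4
  rw [this]
  exact mul_mem (mul_mem hw (s_mem D i)) (inv_mem hw)

/-- a Bruhat step moves `λ` upwards -/
lemma cone_of_cov {lam : D.V} (hdom : D.isDominant lam) {u w : D.V ≃ₗ[ℝ] D.V} (hu : u ∈ D.W)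
    (h : D.bruhatCov u w) : w ∈ D.W ∧ Cone D.alv (u lam - w lam) := by
  obtain ⟨⟨t, ⟨p, hp, ht⟩, hwt⟩, hlen⟩ := h
  have hw : w ∈ D.W := by rw [hwt]; exact mul_mem (refl_mem D hp ht) hu
  refine ⟨hw, ?_⟩
  obtain ⟨q, hq, hqpos, hqt⟩ : ∃ q ∈ D.Phi, Pos D q ∧ ∀ v, t v = D.reflMap q v := by
    rcases pos_or_neg D hp with h | h
    · exact ⟨p, hp, h, ht⟩
    · exact ⟨_, negP_mem D hp, h, fun v => by rw [reflMap_negP, ht]⟩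
  have hwu : ∀ v, w v = D.reflMap q (u v) := by
    intro v; rw [hwt, ← hqt]; rfl
  rcases pos_or_neg D (act_mem D (inv_mem hu) hq) with h | h
  · have h0 := cone_nonneg D hdom h.1
    rw [act_inv_apply] at h0
    have : u lam - w lam = q.1 (u lam) • q.2 := by
      rw [hwu]; simp [ApartmentData.reflMap]
    rw [this]
    exact hqpos.2.smul h0
  · have := length_lt D hu hq hqpos h hwu
    omega

lemma cone_of_bruhatLE {lam : D.V} (hdom : D.isDominant lam) {u w : D.V ≃ₗ[ℝ] D.V} (hu : u ∈ D.W)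
    (h : D.bruhatLE u w) : w ∈ D.W ∧ Cone D.alv (u lam - w lam) := by
  unfold ApartmentData.bruhatLE at h
  induction h with
  | refl => exact ⟨hu, by rw [sub_self]; exact Cone.zero _⟩
  | tail _ hc ih =>
    obtain ⟨h1, h2⟩ := cone_of_cov D hdom ih.1 hc
    refine ⟨h1, ?_⟩
    have := ih.2.add h2
    rwa [sub_add_sub_cancel] at this

lemma neg_of_LT {lam : D.V} (hdom : D.isDominant lam) {u w : D.V ≃ₗ[ℝ] D.V}
    {p : (D.V →ₗ[ℝ] ℝ) × D.V} (hp : p ∈ D.PhiPos) (hu : ∀ v, u v = D.reflMap p (w v))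
    (h : D.bruhatLTmod lam u w) : p.1 (w lam) < 0 := by
  obtain ⟨⟨u', w', hu', hw', eu, ew, hle⟩, hne⟩ := h
  have hc := (cone_of_bruhatLE D hdom hu' hle).2
  rw [eu, ew] at hc
  have e1 : u lam - w lam = (-(p.1 (w lam))) • p.2 := by
    rw [hu]; simp [ApartmentData.reflMap]
  by_contra hge
  push Not at hge
  have h2 : Cone D.alv (-(u lam - w lam)) := by
    rw [e1, neg_smul, neg_neg]
    exact (pos_of_PhiPos D hp).2.smul hge
  exact hne (sub_eq_zero.1 (Cone.antisymm D.free_alv hc h2))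

end LSHecke

/-- Let `π = π(λ,π_0,τ,a)` be a `λ`-path, `1 ≤ j ≤ r−1`, and consider a chain
`σ_{j,i} = r_{β_{j,i}} σ_{j,i−1}` in `W^v/W^v_λ` with `σ_{j,0} = τ_j`,
`σ_{j,s_j} = τ_{j+1}`, positive real roots `β_{j,i}`, and `ξ_i = σ_{j,i}(λ)`.
Then for each `i` the LS condition (i) `σ_{j,i} < σ_{j,i−1}` (Bruhat–Chevalley
order on `W^v/W^v_λ`) is equivalent to the Hecke condition (vi)
`β_{j,i}(ξ_{i−1}) < 0`. If these hold for all `i = 1,…,s_j`, then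
`w_+(a_j) < w_-(a_j)` in the Bruhat–Chevalley order of `W^v/W^v_λ`. -/
theorem LS_condition_iff_Hecke_condition
    (D : ApartmentData) (lam : D.V) (hdom : D.isDominant lam)
    (P : PWPath D lam) (j : ℕ) (hj1 : 1 ≤ j) (hj2 : j < P.r)
    (s : ℕ) (σ : ℕ → D.V ≃ₗ[ℝ] D.V) (β : ℕ → (D.V →ₗ[ℝ] ℝ) × D.V)
    (hσW : ∀ i, σ i ∈ D.W)
    (hσ0 : σ 0 lam = P.τ j lam) (hσs : σ s lam = P.τ (j+1) lam)
    (hβ : ∀ i < s, β i ∈ D.PhiPos)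
    (hrefl : ∀ i < s, ∀ v, σ (i+1) v = D.reflMap (β i) (σ i v)) :
    (∀ i < s,
      (D.bruhatLTmod lam (σ (i+1)) (σ i) ↔ (β i).1 (σ i lam) < 0)) ∧
    ((∀ i < s, D.bruhatLTmod lam (σ (i+1)) (σ i)) →
      D.bruhatLTmod lam (P.τ (j+1)) (P.τ j)) := by
  have hiff : ∀ i < s, (D.bruhatLTmod lam (σ (i+1)) (σ i) ↔ (β i).1 (σ i lam) < 0) := by
    intro i hi
    refine ⟨LSHecke.neg_of_LT D hdom (hβ i hi) (hrefl i hi), fun h => ⟨⟨σ (i+1), σ i, hσW _, hσW _,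
      rfl, rfl, Relation.ReflTransGen.single
        (LSHecke.cov_of_neg D hdom (hσW i) (hβ i hi) (hrefl i hi) h)⟩, ?_⟩⟩
    intro heq
    have h1 := hrefl i hi lam
    rw [heq] at h1
    have h2 := congrArg (β i).1 h1
    simp only [ApartmentData.reflMap, LinearMap.sub_apply, LinearMap.id_apply,
      LinearMap.smulRight_apply, map_sub, map_smul, smul_eq_mul, D.phi_two (hβ i hi).1] at h2
    linarith
  refine ⟨hiff, fun hall => ⟨⟨σ s, σ 0, hσW _, hσW _, hσs, hσ0, ?_⟩, (P.τ_ne j hj1 hj2).symm⟩⟩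
  have hchain : ∀ k ≤ s, D.bruhatLE (σ k) (σ 0) := by
    intro k
    induction k with
    | zero => intro _; exact Relation.ReflTransGen.refl
    | succ k ih =>
      intro hk
      exact Relation.ReflTransGen.head
        (LSHecke.cov_of_neg D hdom (hσW k) (hβ k hk) (hrefl k hk) ((hiff k hk).1 (hall k hk)))
        (ih (by omega))
  exact hchain s le_rfl
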